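/- Let d, m ≥ 1, let (μ_i)_{i∈ℕ} and μ be locally finite Borel measures on ℝᵈ, and suppose that for every continuous compactly supported φ : ℝᵈ → ℝ one has ∫ φ dμ_i → ∫ φ dμ as i → ∞. Let f_i : ℝᵈ → ℝᵐ be μ_i-measurable functions with sup_i ∫ ‖f_i‖² dμ_i < ∞. Then there exist a subsequence (i_j) and a μ-measurable function f : ℝᵈ → ℝᵐ with ∫ ‖f‖² dμ < ∞ such that for every continuous compactly supported Φ : ℝᵈ → ℝᵐ, ∫ ⟨f_{i_j}, Φ⟩ dμ_{i_j} → ∫ ⟨f, Φ⟩ dμ as j → ∞. -/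

import Mathlib

open MeasureTheory
open scoped RealInnerProductSpace ENNReal NNReal

theorem abstract_compactness {W H : Type*} [AddCommGroup W] [Module ℝ W]
    [NormedAddCommGroup H] [InnerProductSpace ℝ H] [CompleteSpace H]
    [SecondCountableTopology H] (ι : W →ₗ[ℝ] H) (T : ℕ → W →ₗ[ℝ] ℝ) (p : ℕ → W → ℝ)
    (K : ℝ) (hK : 0 ≤ K) (hT : ∀ i w, |T i w| ≤ K * p i w)
    (hp : ∀ w, Filter.Tendsto (fun i => p i w) Filter.atTop (nhds ‖ι w‖)) :
    ∃ g : ℕ → ℕ, StrictMono g ∧ ∃ u : H, ∀ w,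
      Filter.Tendsto (fun j => T (g j) w) Filter.atTop (nhds (inner ℝ u (ι w))) := by
  obtain ⟨s, hs⟩ := TopologicalSpace.exists_dense_seq (LinearMap.range ι)
  choose ψ hψ using fun n => (s n).2
  have hB : ∀ n, ∃ B, ∀ i, T i (ψ n) ∈ Set.Icc (-B) B := by
    intro n
    obtain ⟨B, hB⟩ := (hp (ψ n)).bddAbove_range
    refine ⟨K * B, fun i => abs_le.1 ((hT i _).trans ?_)⟩
    exact mul_le_mul_of_nonneg_left (hB ⟨i, rfl⟩) hK
  choose B hB using hB
  obtain ⟨a, -, g, hg, hga⟩ := (isCompact_univ_pi (fun n => isCompact_Icc (a := -B n) (b := B n))).tendsto_subseq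
    (x := fun i n => T i (ψ n)) (fun i n _ => hB n i)
  have hga' : ∀ n, Filter.Tendsto (fun j => T (g j) (ψ n)) Filter.atTop (nhds (a n)) :=
    fun n => (tendsto_pi_nhds.1 hga) n
  have hpg : ∀ w, Filter.Tendsto (fun j => p (g j) w) Filter.atTop (nhds ‖ι w‖) :=
    fun w => (hp w).comp hg.tendsto_atTop
  have hcau : ∀ w, ∃ l, Filter.Tendsto (fun j => T (g j) w) Filter.atTop (nhds l) := by
    intro w
    apply cauchySeq_tendsto_of_complete
    rw [Metric.cauchySeq_iff']
    intro ε hε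
    have hδ : 0 < ε / (4 * (K + 1)) := by positivity
    obtain ⟨n, hn⟩ := hs.exists_dist_lt ⟨ι w, w, rfl⟩ hδ
    have hn' : ‖ι (w - ψ n)‖ < ε / (4 * (K + 1)) := by
      rw [map_sub, hψ n, ← dist_eq_norm]; exact hn
    have h1 := (hpg (w - ψ n)).eventually (gt_mem_nhds hn')
    have h2 := (hga' n).eventually (Metric.ball_mem_nhds _ (show 0 < ε / 4 by positivity))
    obtain ⟨N, hN⟩ := Filter.eventually_atTop.1 (h1.and h2)
    have key : ∀ j ≥ N, |T (g j) w - a n| < ε / 2 := by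
      intro j hj
      obtain ⟨h1, h2⟩ := hN j hj
      have h3 := hT (g j) (w - ψ n)
      rw [map_sub] at h3
      have h4 : K * p (g j) (w - ψ n) ≤ K * (ε / (4 * (K + 1))) :=
        mul_le_mul_of_nonneg_left h1.le hK
      have h5 : K * (ε / (4 * (K + 1))) ≤ ε / 4 := by
        rw [← mul_div_assoc, div_le_div_iff₀ (by positivity) (by positivity)]
        nlinarith
      rw [Real.dist_eq] at h2
      have := abs_sub_le (T (g j) w) (T (g j) (ψ n)) (a n)
      linarith
    refine ⟨N, fun j hj => ?_⟩
    have k1 := key j hj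
    have k2 := key N le_rfl
    rw [Real.dist_eq]
    have := abs_sub_le (T (g j) w) (a n) (T (g N) w)
    rw [abs_sub_comm (a n)] at this
    linarith
  choose L hL using hcau
  have hLb : ∀ w, |L w| ≤ K * ‖ι w‖ := fun w =>
    le_of_tendsto_of_tendsto' (hL w).abs ((hpg w).const_mul K) (fun j => hT _ _)
  let Ll : W →ₗ[ℝ] ℝ :=
    { toFun := L
      map_add' := fun x y => tendsto_nhds_unique (hL (x + y))
        (by simpa using (hL x).add (hL y))
      map_smul' := fun c x => tendsto_nhds_unique (hL (c • x))
        (by simpa using (hL x).const_mul c) }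
  obtain ⟨r, hr⟩ := ι.rangeRestrict.exists_rightInverse_of_surjective ι.range_rangeRestrict
  have hr' : ∀ v, ι (r v) = v := fun v => congrArg Subtype.val (LinearMap.congr_fun hr v)
  let M : LinearMap.range ι →L[ℝ] ℝ := (Ll ∘ₗ r).mkContinuous K (fun v => by
    have := hLb (r v)
    rw [hr'] at this
    exact this)
  obtain ⟨G, hG, -⟩ := exists_extension_norm_eq _ M
  refine ⟨g, hg, (InnerProductSpace.toDual ℝ H).symm G, fun w => ?_⟩
  rw [InnerProductSpace.toDual_symm_apply]
  have e1 : G (ι w) = Ll (r ⟨ι w, w, rfl⟩) := hG ⟨ι w, w, rfl⟩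
  have e2 : Ll (r ⟨ι w, w, rfl⟩ - w) = 0 := by
    have := hLb (r ⟨ι w, w, rfl⟩ - w)
    rw [map_sub ι, hr'] at this
    simp only [sub_self, norm_zero, mul_zero] at this
    exact abs_nonpos_iff.1 this
  rw [map_sub, sub_eq_zero] at e2
  rw [e1, e2]
  exact hL w

/-- The class in `L²(ν)` of a compactly supported continuous function. -/
noncomputable def ccToL2 {d m : ℕ} (ν : Measure (EuclideanSpace ℝ (Fin d)))
    [IsLocallyFiniteMeasure ν] :
    CompactlySupportedContinuousMap (EuclideanSpace ℝ (Fin d)) (EuclideanSpace ℝ (Fin m))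
      →ₗ[ℝ] Lp (EuclideanSpace ℝ (Fin m)) 2 ν where
  toFun Φ := (Φ.continuous.memLp_of_hasCompactSupport (p := 2) (μ := ν) Φ.hasCompactSupport).toLp Φ
  map_add' _ _ := rfl
  map_smul' _ _ := rfl

theorem ccToL2_norm {d m : ℕ} (ν : Measure (EuclideanSpace ℝ (Fin d)))
    [IsLocallyFiniteMeasure ν]
    (Φ : CompactlySupportedContinuousMap (EuclideanSpace ℝ (Fin d)) (EuclideanSpace ℝ (Fin m))) :
    ‖ccToL2 ν Φ‖ = Real.sqrt (∫ x, ‖Φ x‖ ^ 2 ∂ν) := by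
  rw [← Real.sqrt_sq (norm_nonneg (ccToL2 ν Φ)), ← real_inner_self_eq_norm_sq, L2.inner_def]
  congr 1
  apply integral_congr_ae
  filter_upwards [(Φ.continuous.memLp_of_hasCompactSupport (p := 2) (μ := ν)
    Φ.hasCompactSupport).coeFn_toLp] with x hx
  rw [real_inner_self_eq_norm_sq]
  exact congrArg (fun y => ‖y‖ ^ 2) hx

/-- Hutchinson's compactness theorem for measure-function pairs: if `μ_i ⇀ μ` weakly (tested
against continuous compactly supported functions) and the functions `f_i` have uniformly
bounded `L²(μ_i)` norms, then along a subsequence the pairs `(μ_i, f_i)` converge weakly to a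
measure-function pair `(μ, f)` with `f ∈ L²(μ)`. -/
theorem measure_function_pair_compactness (d m : ℕ) (hd : 1 ≤ d) (hm : 1 ≤ m)
    (μseq : ℕ → Measure (EuclideanSpace ℝ (Fin d)))
    (μ : Measure (EuclideanSpace ℝ (Fin d)))
    [∀ i, IsLocallyFiniteMeasure (μseq i)] [IsLocallyFiniteMeasure μ]
    (hweak : ∀ φ : EuclideanSpace ℝ (Fin d) → ℝ, Continuous φ → HasCompactSupport φ →
      Filter.Tendsto (fun i => ∫ x, φ x ∂(μseq i)) Filter.atTop (nhds (∫ x, φ x ∂μ)))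
    (f : ℕ → EuclideanSpace ℝ (Fin d) → EuclideanSpace ℝ (Fin m))
    (hf : ∀ i, AEStronglyMeasurable (f i) (μseq i))
    (C : ℝ≥0∞) (hC : C < ⊤)
    (hbound : ∀ i, ∫⁻ x, (‖f i x‖₊ : ℝ≥0∞) ^ 2 ∂(μseq i) ≤ C) :
    ∃ (g : ℕ → ℕ), StrictMono g ∧
      ∃ flim : EuclideanSpace ℝ (Fin d) → EuclideanSpace ℝ (Fin m),
        AEStronglyMeasurable flim μ ∧
        (∫⁻ x, (‖flim x‖₊ : ℝ≥0∞) ^ 2 ∂μ) < ⊤ ∧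
        ∀ Φ : EuclideanSpace ℝ (Fin d) → EuclideanSpace ℝ (Fin m),
          Continuous Φ → HasCompactSupport Φ →
          Filter.Tendsto (fun j => ∫ x, ⟪f (g j) x, Φ x⟫ ∂(μseq (g j))) Filter.atTop
            (nhds (∫ x, ⟪flim x, Φ x⟫ ∂μ)) := by
  haveI : Fact ((2 : ℝ≥0∞) ≠ ⊤) := ⟨by norm_num⟩
  haveI : SecondCountableTopology (Lp (EuclideanSpace ℝ (Fin m)) 2 μ) := inferInstance
  have hmem : ∀ i, MemLp (f i) 2 (μseq i) := by
    intro i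
    refine ⟨hf i, ?_⟩
    rw [eLpNorm_lt_top_iff_lintegral_rpow_enorm_lt_top (by norm_num) (by norm_num)]
    refine lt_of_le_of_lt ?_ hC
    simpa [enorm_eq_nnnorm] using hbound i
  have hnorm : ∀ i, ‖(hmem i).toLp (f i)‖ ≤ Real.sqrt C.toReal := by
    intro i
    apply Real.le_sqrt_of_sq_le
    rw [Lp.norm_toLp, ← ENNReal.toReal_pow]
    apply ENNReal.toReal_mono hC.ne
    rw [eLpNorm_eq_lintegral_rpow_enorm_toReal (by norm_num) (by norm_num),
      ← ENNReal.rpow_natCast, ← ENNReal.rpow_mul]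
    simpa [enorm_eq_nnnorm] using hbound i
  obtain ⟨g, hg, u, hu⟩ := abstract_compactness (ccToL2 (m := m) μ)
    (fun i => (innerₗ _ ((hmem i).toLp (f i))) ∘ₗ ccToL2 (m := m) (μseq i))
    (fun i Φ => ‖ccToL2 (m := m) (μseq i) Φ‖) (Real.sqrt C.toReal) (Real.sqrt_nonneg _)
    (fun i Φ => (abs_real_inner_le_norm _ _).trans
      (mul_le_mul_of_nonneg_right (hnorm i) (norm_nonneg _)))
    (fun Φ => by
      simp only [ccToL2_norm]
      refine (hweak (fun x => ‖Φ x‖ ^ 2) (by fun_prop) ?_).sqrt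
      exact Φ.hasCompactSupport.comp_left (g := fun y => ‖y‖ ^ 2) (by simp))
  have hmu := Lp.memLp u
  refine ⟨g, hg, u, hmu.1, ?_, fun Φ hΦ hΦc => ?_⟩
  · have := hmu.2
    rw [eLpNorm_lt_top_iff_lintegral_rpow_enorm_lt_top (by norm_num) (by norm_num)] at this
    simpa [enorm_eq_nnnorm] using this
  · have h := hu ⟨⟨Φ, hΦ⟩, hΦc⟩
    convert h using 2
    · rename_i j
      change _ = inner ℝ ((hmem (g j)).toLp (f (g j))) (ccToL2 (μseq (g j)) ⟨⟨Φ, hΦ⟩, hΦc⟩)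
      rw [L2.inner_def]
      apply integral_congr_ae
      filter_upwards [(hmem (g j)).coeFn_toLp, (hΦ.memLp_of_hasCompactSupport (p := 2)
        (μ := μseq (g j)) hΦc).coeFn_toLp] with x h1 h2
      rw [h1]
      exact congrArg (inner ℝ (f (g j) x)) h2.symm
    · rw [L2.inner_def]
      apply integral_congr_ae
      filter_upwards [(hΦ.memLp_of_hasCompactSupport (p := 2) (μ := μ) hΦc).coeFn_toLp] with x h2
      exact congrArg (inner ℝ (u x)) h2.symm
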